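/- Let A be a Noetherian commutative ring and φ : A → A a ring homomorphism such that A, regarded as an A-module via restriction of scalars along φ, is a faithfully flat A-module. Let M be a finitely generated A-module, write φ*M = A ⊗_{A,φ} M for the base change of M along φ, and let C be an arbitrary A-module. If there is an A-module isomorphism M ≅ φ*M ⊕ C, then C = 0 (and hence M ≅ φ*M). -/

import Mathlib

open TensorProduct

section Small

variable {A : Type*} [CommRing A]

lemma Ideal.small_quotient_of_le {I J : Ideal A} (h : I ≤ J) [Small.{v} (A ⧸ I)] :
    Small.{v} (A ⧸ J) :=
  small_of_surjective (Ideal.Quotient.factor_surjective h)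

lemma Module.Finite.small_of_le_annihilator {N : Type*} [AddCommGroup N] [Module A N]
    [Module.Finite A N] {J : Ideal A} [Small.{v} (A ⧸ J)] (h : J ≤ Module.annihilator A N) :
    Small.{v} N := by
  have hJ : Module.IsTorsionBySet A N J := fun x j ↦ Module.mem_annihilator.mp (h j.2) x
  let := hJ.module
  have : IsScalarTower A (A ⧸ J) N := hJ.isScalarTower
  have : Module.Finite (A ⧸ J) N := Module.Finite.of_restrictScalars_finite A (A ⧸ J) N
  exact Module.Finite.small (A ⧸ J) N

lemma LinearMap.small_of_small_ker {M N : Type*} [AddCommGroup M] [Module A M] [AddCommGroup N]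
    [Module A N] (f : M →ₗ[A] N) [Small.{v} N] [Small.{v} (LinearMap.ker f)] : Small.{v} M := by
  have : Small.{v} (M ⧸ LinearMap.ker f) :=
    small_of_injective (f := Submodule.liftQ (LinearMap.ker f) f le_rfl)
      (LinearMap.ker_eq_bot.mp (Submodule.ker_liftQ_eq_bot _ _ _ le_rfl))
  have : Small.{v} (M ⧸ (LinearMap.ker f).toAddSubgroup) :=
    inferInstanceAs (Small.{v} (M ⧸ LinearMap.ker f))
  have : Small.{v} (LinearMap.ker f).toAddSubgroup :=
    inferInstanceAs (Small.{v} (LinearMap.ker f))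
  exact small_map
    (AddSubgroup.addGroupEquivQuotientProdAddSubgroup (s := (LinearMap.ker f).toAddSubgroup))

lemma Ideal.small_quotient_annihilator (M : Type*) [AddCommGroup M] [Module A M]
    [Small.{v} M] : Small.{v} (A ⧸ Module.annihilator A M) :=
  small_of_injective (β := M → M)
    (f := fun a m ↦ Ideal.Quotient.lift (Module.annihilator A M) (Module.toAddMonoidEnd A M)
      (fun a ha ↦ by ext m; exact Module.mem_annihilator.mp ha m) a m) <| by
    intro a b hab
    obtain ⟨a, rfl⟩ := Ideal.Quotient.mk_surjective a
    obtain ⟨b, rfl⟩ := Ideal.Quotient.mk_surjective b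
    refine Ideal.Quotient.eq.mpr (Module.mem_annihilator.mpr fun m ↦ ?_)
    rw [sub_smul, sub_eq_zero]
    exact congrFun hab m

lemma IsIdempotentElem.eq_zero_of_mem_minimalPrimes {e : A} (he : IsIdempotentElem e)
    (h : ∀ p ∈ minimalPrimes A, e ∈ p) : e = 0 := by
  have : e ∈ (⊥ : Ideal A).radical := by
    rw [← Ideal.sInf_minimalPrimes]
    exact Ideal.mem_sInf.mpr fun {p} hp ↦ h p hp
  obtain ⟨n, hn⟩ := this
  rcases n.eq_zero_or_pos with rfl | hpos
  · have h1 : (1 : A) = 0 := by simpa using hn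
    rw [← mul_one e, h1, mul_zero]
  · rwa [he.pow_eq hpos.ne'] at hn

variable [IsNoetherianRing A]

lemma Ideal.small_quotient_mul (I J : Ideal A) [Small.{v} (A ⧸ I)] [Small.{v} (A ⧸ J)] :
    Small.{v} (A ⧸ I * J) := by
  let f : (A ⧸ I * J) →ₗ[A] (A ⧸ J) := Submodule.factor Ideal.mul_le_right
  have : Small.{v} (LinearMap.ker f) := by
    refine Module.Finite.small_of_le_annihilator (A := A) (J := I) fun i hi ↦
      Module.mem_annihilator.mpr ?_
    rintro ⟨x, hx⟩
    obtain ⟨a, rfl⟩ := Ideal.Quotient.mk_surjective x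
    have ha : a ∈ J := Ideal.Quotient.eq_zero_iff_mem.mp hx
    exact Subtype.ext (Ideal.Quotient.eq_zero_iff_mem.mpr (Ideal.mul_mem_mul hi ha))
  exact f.small_of_small_ker

lemma Ideal.small_quotient_pow (I : Ideal A) [Small.{v} (A ⧸ I)] (n : ℕ) :
    Small.{v} (A ⧸ I ^ n) := by
  induction n with
  | zero => rw [pow_zero]; exact Ideal.small_quotient_of_le (I := I) (by simp)
  | succ n ih => rw [pow_succ]; exact Ideal.small_quotient_mul _ _

lemma Ideal.small_quotient_iInf_pow (I : Ideal A) [Small.{v} (A ⧸ I)] :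
    Small.{v} (A ⧸ ⨅ n : ℕ, I ^ n) := by
  have := I.small_quotient_pow
  refine small_of_injective (β := ∀ n : ℕ, A ⧸ I ^ n)
    (f := fun a n ↦ Ideal.Quotient.factor (iInf_le (fun n : ℕ ↦ I ^ n) n) a) ?_
  intro a b hab
  obtain ⟨a, rfl⟩ := Ideal.Quotient.mk_surjective a
  obtain ⟨b, rfl⟩ := Ideal.Quotient.mk_surjective b
  exact Ideal.Quotient.eq.mpr ((Submodule.mem_iInf _).mpr fun n ↦
    Ideal.Quotient.eq.mp (congrFun hab n))

/-- By Krull's intersection theorem, an ideal with small quotient contains an element congruent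
to `1` modulo the ideal and generating a small ideal. -/
lemma Ideal.exists_sub_one_mem_and_small_span (I : Ideal A) [Small.{v} (A ⧸ I)] :
    ∃ r : A, r - 1 ∈ I ∧ Small.{v} (Ideal.span {r}) := by
  let K : Ideal A := ⨅ n : ℕ, I ^ n
  have hK : K ≤ I • K := fun x hx ↦ by
    obtain ⟨r, hr⟩ := (I.mem_iInf_smul_pow_eq_bot_iff x).mp (by simpa [K] using hx)
    rw [← hr]
    exact Submodule.smul_mem_smul r.2 hx
  obtain ⟨r, hr, hrK⟩ := Submodule.exists_sub_one_mem_and_smul_eq_zero_of_fg_of_le_smul I K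
    (IsNoetherian.noetherian K) hK
  have : Small.{v} (A ⧸ K) := I.small_quotient_iInf_pow
  refine ⟨r, hr, Module.Finite.small_of_le_annihilator (A := A) (J := K) fun k hk ↦
    Module.mem_annihilator.mpr ?_⟩
  rintro ⟨x, hx⟩
  obtain ⟨a, rfl⟩ := Ideal.mem_span_singleton'.mp hx
  refine Subtype.ext ?_
  have := hrK k hk
  simp only [smul_eq_mul] at this
  simp only [SetLike.mk_smul_mk, smul_eq_mul, ZeroMemClass.coe_zero]
  linear_combination a * this

lemma Ideal.exists_small_forall_small_le (A : Type*) [CommRing A] [IsNoetherianRing A] :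
    ∃ T : Ideal A, Small.{v} T ∧ ∀ I : Ideal A, Small.{v} I → I ≤ T := by
  obtain ⟨T, hT, hmax⟩ := set_has_maximal_iff_noetherian.mpr ‹IsNoetherianRing A›
    {I : Ideal A | Small.{v} I} ⟨⊥, inferInstanceAs (Small.{v} (⊥ : Ideal A))⟩
  refine ⟨T, hT, fun I hI ↦ ?_⟩
  have : Small.{v} T := hT
  have h : ¬ T < T ⊔ I := hmax (T ⊔ I) (Submodule.small_sup (P := T) (Q := I))
  exact sup_eq_left.mp (le_sup_left.eq_of_not_lt h).symm

/-- A Noetherian ring splits as a product of a small ring and a ring without nonzero small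
quotients. -/
lemma Ideal.exists_isIdempotentElem_small_quotient_iff (A : Type*) [CommRing A]
    [IsNoetherianRing A] :
    ∃ e : A, IsIdempotentElem e ∧ ∀ I : Ideal A, Small.{v} (A ⧸ I) ↔ 1 - e ∈ I := by
  obtain ⟨T, hT, hmax⟩ := Ideal.exists_small_forall_small_le.{_, v} A
  have key (I : Ideal A) (_ : Small.{v} (A ⧸ I)) : ∃ r ∈ T, r - 1 ∈ I := by
    obtain ⟨r, hr, hs⟩ := I.exists_sub_one_mem_and_small_span
    exact ⟨r, hmax _ hs (Ideal.mem_span_singleton_self r), hr⟩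
  have hann : Small.{v} (A ⧸ Module.annihilator A T) := Ideal.small_quotient_annihilator T
  obtain ⟨e, heT, he⟩ := key _ hann
  have he' (t : A) (ht : t ∈ T) : (e - 1) * t = 0 :=
    congrArg Subtype.val (Module.mem_annihilator.mp he ⟨t, ht⟩)
  refine ⟨e, ?_, fun I ↦ ⟨fun hI ↦ ?_, fun hI ↦ ?_⟩⟩
  · have := he' e heT
    rw [IsIdempotentElem]
    linear_combination this
  · obtain ⟨r, hrT, hr⟩ := key I hI
    have : 1 - e = (e - 1) * (r - 1) := by linear_combination -he' r hrT
    rw [this]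
    exact I.mul_mem_left _ hr
  · refine Ideal.small_quotient_of_le (I := Module.annihilator A T) fun a ha ↦ ?_
    have hae : a * e = 0 := congrArg Subtype.val (Module.mem_annihilator.mp ha ⟨e, heT⟩)
    have : a = a * (1 - e) := by linear_combination hae
    rw [this]
    exact I.mul_mem_left _ hI

instance IsNoetherianRing.finite_isIdempotentElem (A : Type*) [CommRing A] [IsNoetherianRing A] :
    Finite {e : A // IsIdempotentElem e} := by
  have : Finite (minimalPrimes A) := minimalPrimes.finite_of_isNoetherianRing A
  refine Finite.of_injective
    (fun e : {e : A // IsIdempotentElem e} ↦ {p : minimalPrimes A | e.1 ∈ p.1}) ?_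
  have key (e f : {e : A // IsIdempotentElem e})
      (h : ∀ p ∈ minimalPrimes A, e.1 ∈ p ∨ 1 - f.1 ∈ p) : e.1 * (1 - f.1) = 0 :=
    (e.2.mul f.2.one_sub).eq_zero_of_mem_minimalPrimes fun p hp ↦
      (h p hp).elim (p.mul_mem_right _) (p.mul_mem_left _)
  have or_mem (f : {e : A // IsIdempotentElem e}) (p : Ideal A) (hp : p ∈ minimalPrimes A) :
      f.1 ∈ p ∨ 1 - f.1 ∈ p := by
    have : p.IsPrime := hp.1.1
    refine Ideal.IsPrime.mem_or_mem ‹_› ?_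
    rw [f.2.mul_one_sub_self]
    exact p.zero_mem
  intro e f hef
  have h (p) (hp : p ∈ minimalPrimes A) : e.1 ∈ p ↔ f.1 ∈ p := Set.ext_iff.mp hef ⟨p, hp⟩
  have h1 := key e f fun p hp ↦ (or_mem f p hp).imp_left (h p hp).mpr
  have h2 := key f e fun p hp ↦ (or_mem e p hp).imp_left (h p hp).mp
  exact Subtype.ext (by linear_combination h1 - h2)

lemma Ideal.small_quotient_map_of_injective {φ : A →+* A} (hφ : Function.Injective φ)
    (I : Ideal A) [Small.{v} (A ⧸ I)] : Small.{v} (A ⧸ I.map φ) := by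
  obtain ⟨e, he, hI⟩ := Ideal.exists_isIdempotentElem_small_quotient_iff.{_, v} A
  obtain ⟨n, hn, hper⟩ : ∃ n > 0, φ^[n] e = e := by
    let Φ : {e : A // IsIdempotentElem e} → {e : A // IsIdempotentElem e} :=
      fun e ↦ ⟨φ e.1, e.2.map φ⟩
    have hΦ : Function.Injective Φ := fun a b hab ↦
      Subtype.ext (hφ (congrArg Subtype.val hab))
    obtain ⟨n, hn, hp⟩ := hΦ.mem_periodicPts ⟨e, he⟩
    refine ⟨n, hn, ?_⟩
    have hsemi : Function.Semiconj Subtype.val Φ φ := fun _ ↦ rfl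
    have := (hsemi.iterate_right n).eq ⟨e, he⟩
    rw [hp.eq] at this
    exact this.symm
  obtain ⟨n, rfl⟩ := Nat.exists_eq_succ_of_ne_zero hn.ne'
  have : Small.{v} (A ⧸ Ideal.span {1 - e}) :=
    (hI _).mpr (Ideal.mem_span_singleton_self _)
  let g : A →+* A ⧸ Ideal.span {1 - e} := (Ideal.Quotient.mk _).comp (φ ^ n)
  have : Small.{v} (A ⧸ RingHom.ker g) :=
    small_of_injective (RingHom.kerLift_injective g)
  refine Ideal.small_quotient_of_le (I := RingHom.ker g) fun x hx ↦ ?_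
  obtain ⟨c, hc⟩ := Ideal.mem_span_singleton'.mp (Ideal.Quotient.eq_zero_iff_mem.mp hx)
  have hx0 : x * φ e = 0 := by
    refine hφ.iterate n ?_
    rw [← RingHom.coe_pow, map_mul, map_zero, ← hc, RingHom.coe_pow,
      ← Function.iterate_succ_apply, hper]
    linear_combination -c * he.eq
  have : x = x * φ (1 - e) := by
    rw [map_sub, map_one]
    linear_combination hx0
  rw [this]
  exact Ideal.mul_mem_left _ _ (Ideal.mem_map_of_mem φ ((hI I).mp ‹_›))

end Small

/-- Two submodules whose images under a base change map `ι` span the same submodule agree, if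
the base change is faithfully flat and small enough for the universal property to apply. -/
lemma Submodule.eq_of_span_image_eq_of_faithfullyFlat {A B : Type*} [CommRing A] [CommRing B]
    (φ : A →+* B) (hff : φ.FaithfullyFlat)
    (hsmall : ∀ I : Ideal A, Small.{v} (A ⧸ I) → Small.{v} (B ⧸ I.map φ))
    {M : Type v} [AddCommGroup M] [Module A M] [Module.Finite A M]
    {P : Type v} [AddCommGroup P] [Module B P] (ι : M →ₛₗ[φ] P)
    (hP : ∀ (N : Type v) [AddCommGroup N] [Module B N] (g : M →ₛₗ[φ] N),
      ∃ h : P →ₗ[B] N, ∀ m : M, h (ι m) = g m)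
    {N N' : Submodule A M} (h : span B (ι '' N) = span B (ι '' N')) : N = N' := by
  algebraize [φ]
  have : Small.{v} (B ⊗[A] M) := by
    have := hsmall _ (Ideal.small_quotient_annihilator (A := A) M)
    refine Module.Finite.small_of_le_annihilator (A := B)
      (J := (Module.annihilator A M).map φ) (Ideal.map_le_iff_le_comap.mpr fun a ha ↦
        Module.mem_annihilator.mpr fun x ↦ ?_)
    change algebraMap A B a • x = 0
    rw [algebraMap_smul]
    induction x with
    | zero => exact smul_zero a
    | add x y hx hy => rw [smul_add, hx, hy, add_zero]
    | tmul b m => rw [← tmul_smul, Module.mem_annihilator.mp ha m, tmul_zero]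
  let s : B ⊗[A] M ≃ₗ[B] Shrink.{v} (B ⊗[A] M) := (Shrink.linearEquiv B (B ⊗[A] M)).symm
  let g : M →ₛₗ[φ] Shrink.{v} (B ⊗[A] M) :=
    { toFun := fun m ↦ s (1 ⊗ₜ m)
      map_add' := fun x y ↦ by rw [tmul_add, map_add]
      map_smul' := fun a m ↦ by
        rw [← map_smul, tmul_smul]
        exact congrArg s (algebraMap_smul B a (1 ⊗ₜ[A] m)).symm }
  obtain ⟨k, hk⟩ := hP _ g
  have himage (L : Submodule A M) :
      (span B (ι '' L)).map (s.symm.toLinearMap ∘ₗ k) = L.baseChange B := by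
    rw [map_span, ← Set.image_comp, baseChange_eq_span, map_coe]
    congr 1
    refine Set.image_congr fun m _ ↦ ?_
    simp [hk, g]
  refine baseChange_injective (A := B) ?_
  rw [← himage, ← himage, h]

/-- Let `A` be a Noetherian commutative ring and `φ : A → A` a ring homomorphism making
`A` a faithfully flat `A`-module via restriction of scalars along `φ`.  Let `M` be a
finitely generated `A`-module and let `P` (together with the `φ`-semilinear map
`ι : M → P`) be the base change `φ^* M = A ⊗_{A,φ} M` of `M` along `φ`, characterized by
its universal property among `φ`-semilinear maps out of `M`.  If `M ≅ φ^* M ⊕ C` for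
some `A`-module `C`, then `C = 0` and hence `M ≅ φ^* M`. -/
theorem direct_summand_frobenius_twist_trivial
    {A : Type u} [CommRing A] [IsNoetherianRing A] (φ : A →+* A)
    (hff : @Module.FaithfullyFlat A A _ _ (Module.compHom A φ))
    (M : Type v) [AddCommGroup M] [Module A M] [Module.Finite A M]
    (P : Type v) [AddCommGroup P] [Module A P] (ι : M →ₛₗ[φ] P)
    (hP : ∀ (N : Type v) [AddCommGroup N] [Module A N] (g : M →ₛₗ[φ] N),
      ∃! h : P →ₗ[A] N, ∀ m : M, h (ι m) = g m)
    (C : Type v) [AddCommGroup C] [Module A C]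
    (e : M ≃ₗ[A] P × C) :
    Subsingleton C ∧ Nonempty (M ≃ₗ[A] P) := by
  have hff : φ.FaithfullyFlat := hff
  have hspan {N N' : Submodule A M}
      (h : Submodule.span A (ι '' N) = Submodule.span A (ι '' N')) : N = N' :=
    Submodule.eq_of_span_image_eq_of_faithfullyFlat φ hff
      (fun I _ ↦ I.small_quotient_map_of_injective hff.injective) ι
      (fun N _ _ g ↦ (hP N g).exists) h
  let F (N : Submodule A M) : Submodule A M :=
    ((Submodule.span A (ι '' N)).prod ⊤).comap e.toLinearMap
  have hF : StrictMono F := by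
    refine Monotone.strictMono_of_injective (fun N N' h ↦ Submodule.comap_mono
      (Submodule.prod_mono (Submodule.span_mono (Set.image_mono h)) le_rfl)) fun N N' h ↦ ?_
    refine hspan (Submodule.ext fun p ↦ ?_)
    have := SetLike.ext_iff.mp h (e.symm (p, 0))
    simpa [F] using this
  have hbot : F ⊥ = ⊥ := by
    by_contra hne
    exact not_strictMono_of_wellFoundedGT _
      (hF.strictMono_iterate_of_lt_map (bot_lt_iff_ne_bot.mpr hne))
  have hC : Subsingleton C := by
    refine subsingleton_of_forall_eq 0 fun c ↦ ?_
    have hc : e.symm (0, c) ∈ F ⊥ := by simp [F]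
    rw [hbot, Submodule.mem_bot, LinearEquiv.map_eq_zero_iff] at hc
    exact congrArg Prod.snd hc
  have : Unique C := uniqueOfSubsingleton 0
  exact ⟨hC, ⟨e ≪≫ₗ LinearEquiv.prodUnique⟩⟩
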